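/- For every Q₁=(q₁,q₂), Q₃=(q₅,q₆) ∈ {0,1}², every sign s ∈ {+1,−1}, and all bits i,j,k,l ∈ {0,1} with i+j odd and k+l odd, the 6-qubit vectors v_{10,s} and v_{11,s} satisfy (P_k ⊗ P_l ⊗ P_i ⊗ P_j ⊗ I ⊗ I) v_{10,s} = s · (√−1)^{i+j+k+l} · (−1)^{k q₁ + l q₂} · v_{10,s} and (P_k ⊗ P_l ⊗ P_i ⊗ P_j ⊗ I ⊗ I) v_{11,s} = s · (√−1)^{i+j+k+l} · (−1)^{k q₁ + l q₂ + i} · v_{11,s}. -/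

import Mathlib

open Matrix Complex

noncomputable section

/-- Single-qubit Pauli X. -/
def Xg : Matrix (Fin 2) (Fin 2) ℂ := !![0, 1; 1, 0]
/-- Single-qubit Pauli Y. -/
def Yg : Matrix (Fin 2) (Fin 2) ℂ := !![0, -Complex.I; Complex.I, 0]
/-- Single-qubit Pauli Z. -/
def Zg : Matrix (Fin 2) (Fin 2) ℂ := !![1, 0; 0, -1]
/-- P₀ = X, P₁ = Y. -/
def Pg : Fin 2 → Matrix (Fin 2) (Fin 2) ℂ := fun i => if i = 0 then Xg else Yg

/-- Tensor (Kronecker) product of `n` single-qubit operators, as a matrix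
indexed by bit strings. -/
def tens {n : ℕ} (M : Fin n → Matrix (Fin 2) (Fin 2) ℂ) :
    Matrix (Fin n → Fin 2) (Fin n → Fin 2) ℂ :=
  Matrix.of fun r c => ∏ m, M m (r m) (c m)

/-- Computational basis vector |q⟩. -/
def ket {n : ℕ} (q : Fin n → Fin 2) : (Fin n → Fin 2) → ℂ :=
  fun r => if r = q then 1 else 0

/-- The eigenvector v_{10,s} of the paper (6 qubits). -/
def v10 (q₁ q₂ q₅ q₆ : Fin 2) (s : ℂ) : (Fin 6 → Fin 2) → ℂ :=
  (- ket ![q₁, q₂, 0, 0, q₅, q₆] + ket ![q₁+1, q₂+1, 0, 0, q₅, q₆]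
    + ket ![q₁, q₂, 0, 0, q₅+1, q₆+1] + ket ![q₁+1, q₂+1, 0, 0, q₅+1, q₆+1])
  + s • (- ket ![q₁+1, q₂+1, 1, 1, q₅, q₆] - ket ![q₁, q₂, 1, 1, q₅, q₆]
    + ket ![q₁+1, q₂+1, 1, 1, q₅+1, q₆+1] - ket ![q₁, q₂, 1, 1, q₅+1, q₆+1])

/-- The eigenvector v_{11,s} of the paper (6 qubits). -/
def v11 (q₁ q₂ q₅ q₆ : Fin 2) (s : ℂ) : (Fin 6 → Fin 2) → ℂ :=
  (- ket ![q₁, q₂, 0, 1, q₅, q₆] + ket ![q₁+1, q₂+1, 0, 1, q₅, q₆]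
    + ket ![q₁, q₂, 0, 1, q₅+1, q₆+1] + ket ![q₁+1, q₂+1, 0, 1, q₅+1, q₆+1])
  + s • (ket ![q₁+1, q₂+1, 1, 0, q₅, q₆] + ket ![q₁, q₂, 1, 0, q₅, q₆]
    - ket ![q₁+1, q₂+1, 1, 0, q₅+1, q₆+1] + ket ![q₁, q₂, 1, 0, q₅+1, q₆+1])

lemma tens_mulVec_ket {n : ℕ} (M : Fin n → Matrix (Fin 2) (Fin 2) ℂ) (q r : Fin n → Fin 2) :
    (tens M).mulVec (ket q) r = ∏ m, M m (r m) (q m) := by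
  simp [Matrix.mulVec, dotProduct, tens, ket]

lemma ket_apply_eq_prod {n : ℕ} (q r : Fin n → Fin 2) :
    ket q r = ∏ m, Pi.single (M := fun _ => ℂ) (r m) 1 (q m) := by
  simp [ket, ← Matrix.one_eq_pi_single, Matrix.one_apply, Finset.prod_ite_zero, funext_iff]

lemma Pg_apply (i a b : Fin 2) :
    Pg i a b = Complex.I ^ (i : ℕ) * (-1) ^ ((i : ℕ) * (b : ℕ)) *
      Pi.single (M := fun _ => ℂ) a 1 (b + 1) := by
  rw [← Matrix.one_eq_pi_single, Matrix.one_apply]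
  fin_cases i <;> fin_cases a <;> fin_cases b <;> simp [Pg, Xg, Yg]

/-- A product of `X`s and `Y`s on the first four qubits flips them, up to a phase. -/
lemma tens_Pg_mulVec_ket (i j k l a b c d e f : Fin 2) :
    (tens ![Pg k, Pg l, Pg i, Pg j, 1, 1]).mulVec (ket ![a, b, c, d, e, f]) =
      (Complex.I ^ ((i : ℕ) + (j : ℕ) + (k : ℕ) + (l : ℕ)) *
        (-1 : ℂ) ^ ((k : ℕ) * (a : ℕ) + (l : ℕ) * (b : ℕ) + (i : ℕ) * (c : ℕ) +
          (j : ℕ) * (d : ℕ))) • ket ![a + 1, b + 1, c + 1, d + 1, e, f] := by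
  ext r
  rw [tens_mulVec_ket, Pi.smul_apply, ket_apply_eq_prod, smul_eq_mul]
  simp only [Fin.prod_univ_six, Matrix.cons_val, Pg_apply, Matrix.one_eq_pi_single]
  ring

/-- Bits with odd sum are complementary. -/
lemma eq_zero_one_or_one_zero_of_odd {i j : Fin 2} (h : Odd ((i : ℕ) + (j : ℕ))) :
    i = 0 ∧ j = 1 ∨ i = 1 ∧ j = 0 := by
  revert i j
  decide

lemma neg_one_pow_val_add_one (a : Fin 2) :
    (-1 : ℂ) ^ ((a + 1 : Fin 2) : ℕ) = -(-1) ^ (a : ℕ) := by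
  fin_cases a <;> simp

lemma fin_two_add_one_add_one (a : Fin 2) : a + 1 + 1 = a := by
  revert a
  decide

theorem stmt7 (q₁ q₂ q₅ q₆ : Fin 2) (s : ℂ) (hs : s = 1 ∨ s = -1)
    (i j k l : Fin 2) (hij : Odd ((i : ℕ) + (j : ℕ))) (hkl : Odd ((k : ℕ) + (l : ℕ))) :
    (tens ![Pg k, Pg l, Pg i, Pg j, 1, 1]).mulVec (v10 q₁ q₂ q₅ q₆ s) =
      (s * Complex.I ^ ((i : ℕ) + (j : ℕ) + (k : ℕ) + (l : ℕ)) *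
        (-1 : ℂ) ^ ((k : ℕ) * (q₁ : ℕ) + (l : ℕ) * (q₂ : ℕ))) • v10 q₁ q₂ q₅ q₆ s ∧
    (tens ![Pg k, Pg l, Pg i, Pg j, 1, 1]).mulVec (v11 q₁ q₂ q₅ q₆ s) =
      (s * Complex.I ^ ((i : ℕ) + (j : ℕ) + (k : ℕ) + (l : ℕ)) *
        (-1 : ℂ) ^ ((k : ℕ) * (q₁ : ℕ) + (l : ℕ) * (q₂ : ℕ) + (i : ℕ))) •
        v11 q₁ q₂ q₅ q₆ s := by
  have h01 : (0 : Fin 2) + 1 = 1 := rfl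
  have h10 : (1 : Fin 2) + 1 = 0 := rfl
  have hss : s * s = 1 := by rcases hs with rfl | rfl <;> norm_num
  constructor <;>
  · simp only [v10, v11, Matrix.mulVec_add, Matrix.mulVec_sub, Matrix.mulVec_neg,
      Matrix.mulVec_smul, tens_Pg_mulVec_ket, fin_two_add_one_add_one, h01, h10]
    rcases eq_zero_one_or_one_zero_of_odd hij with ⟨rfl, rfl⟩ | ⟨rfl, rfl⟩ <;>
    rcases eq_zero_one_or_one_zero_of_odd hkl with ⟨rfl, rfl⟩ | ⟨rfl, rfl⟩ <;>
    · simp only [Fin.val_zero, Fin.val_one, zero_mul, one_mul, mul_zero, zero_add, add_zero,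
        pow_add, neg_one_pow_val_add_one, pow_one, mul_one]
      match_scalars <;> grind
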